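/- Let G,G' be multi-valued regulatory graphs sharing the same V and ρ, with parametrizations K ∈ K_G and K' ∈ K_{G'}. Denote Comp*(G,K) and Comp*(G',K') the fixed points obtained by iterating the completion Comp starting in (G,K) and (G',K') respectively. Then T_G(K) = T_{G'}(K') if and only if Can(Comp*(G,K)) = Can(Comp*(G',K')). -/

import Mathlib

/-!
Formalization of multi-valued regulatory graphs (Thomas networks),
their parametrizations, asynchronous transition systems,
canonization, completion, normalization and minimization.
-/

namespace MVReg

open Classical

/-- A multi-valued regulatory graph over components `V` with maximal
activity levels `ρ`: a finite set of regulations `(u, n, v)` with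
threshold `0 < n ≤ ρ u`. -/
structure RegGraph (V : Type*) (ρ : V → ℕ) where
  E : Finset (V × ℕ × V)
  valid : ∀ e ∈ E, 1 ≤ e.2.1 ∧ e.2.1 ≤ ρ e.1

/-- A (total) parametrization candidate: a value for each component and
each potential regulatory context (a context assigns to each regulator
an interval, represented by its pair of endpoints `[j, k)`). -/
abbrev Param (V : Type*) := V → (V → ℕ × ℕ) → ℕ

variable {V : Type*} [DecidableEq V] [Fintype V] {ρ : V → ℕ}

/-- The extended threshold set `Θ(u,v) = θ(u,v) ∪ {0, ρ u + 1}`. -/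
def Theta (G : RegGraph V ρ) (u v : V) : Set ℕ :=
  {m | (u, m, v) ∈ G.E} ∪ {0, ρ u + 1}

/-- Activity intervals `I_v^u`: pairs `(j,k)` (representing `[j,k)`) of
consecutive members of `Θ(u,v)`. -/
def ActInterval (G : RegGraph V ρ) (u v : V) : Set (ℕ × ℕ) :=
  {p | p.1 ∈ Theta G u v ∧ p.2 ∈ Theta G u v ∧ p.1 < p.2 ∧
    ∀ l ∈ Theta G u v, ¬ (p.1 < l ∧ l < p.2)}

/-- The regulatory contexts `Ω_v` of a component `v`. -/
def Context (G : RegGraph V ρ) (v : V) : Set (V → ℕ × ℕ) :=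
  {ω | ∀ u, ω u ∈ ActInterval G u v}

/-- `K ∈ 𝒦_G` : on every regulatory context of `v` the value lies in `[0, ρ v]`. -/
def IsParam (G : RegGraph V ρ) (K : Param V) : Prop :=
  ∀ v : V, ∀ ω ∈ Context G v, K v ω ≤ ρ v

/-- The state space `S = ∏_v [0, ρ v]`. -/
def States (ρ : V → ℕ) : Set (V → ℕ) := {s | ∀ v, s v ≤ ρ v}

/-- `s ∈ ω` : the state `s` lies in the context `ω`. -/
def memCtx (ω : V → ℕ × ℕ) (s : V → ℕ) : Prop :=
  ∀ u, (ω u).1 ≤ s u ∧ s u < (ω u).2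

/-- The (unique) regulatory context of `v` containing the state `s`. -/
noncomputable def ctxOf (G : RegGraph V ρ) (v : V) (s : V → ℕ) : V → ℕ × ℕ :=
  fun u => (sSup {m | m ∈ Theta G u v ∧ m ≤ s u}, sInf {m | m ∈ Theta G u v ∧ s u < m})

/-- The asynchronous update function `F^K_v`. -/
noncomputable def F (G : RegGraph V ρ) (K : Param V) (v : V) (s : V → ℕ) : ℕ :=
  if s v < K v (ctxOf G v s) then s v + 1
  else if s v = K v (ctxOf G v s) then s v
  else s v - 1

/-- The derivative `δ(F^K_v)(s) = F^K_v(s) − s_v` (as an integer). -/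
noncomputable def delta (G : RegGraph V ρ) (K : Param V) (v : V) (s : V → ℕ) : ℤ :=
  (F G K v s : ℤ) - (s v : ℤ)

/-- The asynchronous transition system `T_G(K)`, as the set of transitions. -/
noncomputable def TS (G : RegGraph V ρ) (K : Param V) : Set ((V → ℕ) × (V → ℕ)) :=
  {p | p.1 ∈ States ρ ∧ p.2 ∈ States ρ ∧ p.1 ≠ p.2 ∧
    ∃ v : V, p.2 = Function.update p.1 v (F G K v p.1)}

/-- The synchronous transition system of `(G, K)`. -/
noncomputable def SyncTS (G : RegGraph V ρ) (K : Param V) : Set ((V → ℕ) × (V → ℕ)) :=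
  {p | p.1 ∈ States ρ ∧ p.2 ∈ States ρ ∧ ∀ v : V, p.2 v = F G K v p.1}

/-- A parametrization is canonical iff `j − 1 ≤ K_v(ω) ≤ k` for every context with
`ω_v = [j,k)`. -/
def Canonical (G : RegGraph V ρ) (K : Param V) : Prop :=
  ∀ v : V, ∀ ω ∈ Context G v, (ω v).1 - 1 ≤ K v ω ∧ K v ω ≤ (ω v).2

/-- The canonization of a parametrization. -/
noncomputable def CanP (K : Param V) : Param V := fun v ω =>
  if K v ω + 1 < (ω v).1 then (ω v).1 - 1
  else if (ω v).2 < K v ω then (ω v).2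
  else K v ω

/-- A regulatory graph is complete iff it contains every possible edge. -/
def Complete (G : RegGraph V ρ) : Prop :=
  ∀ u v : V, ∀ n : ℕ, 1 ≤ n → n ≤ ρ u → (u, n, v) ∈ G.E

/-- The finite set of all possible edges for activity levels `ρ`. -/
def allEdges (ρ : V → ℕ) : Finset (V × ℕ × V) :=
  Finset.filter (fun e => 1 ≤ e.2.1 ∧ e.2.1 ≤ ρ e.1)
    (Finset.univ ×ˢ (Finset.Icc 1 (Finset.univ.sup ρ)) ×ˢ Finset.univ)

/-- `n_−`: the largest element of `Θ(u,v)` strictly below `n`. -/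
noncomputable def nminus (G : RegGraph V ρ) (u v : V) (n : ℕ) : ℕ :=
  sSup {m | m ∈ Theta G u v ∧ m < n}

/-- `n_+`: the smallest element of `Θ(u,v)` strictly above `n`. -/
noncomputable def nplus (G : RegGraph V ρ) (u v : V) (n : ℕ) : ℕ :=
  sInf {m | m ∈ Theta G u v ∧ n < m}

/-- The parametrization accompanying the completion by the edge `e = (u, n, v)`:
the two contexts obtained by splitting a context of `G` at `n` both inherit the
original value. (`n_−, n_+` are taken w.r.t. the graph `G` before insertion.) -/
noncomputable def CompParam (G : RegGraph V ρ) (K : Param V) (e : V × ℕ × V) : Param V :=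
  fun w ω =>
    if w = e.2.2 ∧ (ω e.1 = (nminus G e.1 e.2.2 e.2.1, e.2.1) ∨
                    ω e.1 = (e.2.1, nplus G e.1 e.2.2 e.2.1))
    then K e.2.2 (Function.update ω e.1 (nminus G e.1 e.2.2 e.2.1, nplus G e.1 e.2.2 e.2.1))
    else K w ω

/-- One completion step: add the least missing edge (w.r.t. the fixed total
order) and extend the parametrization conservatively; complete graphs are fixed. -/
noncomputable def Comp [LinearOrder (V × ℕ × V)] (P : RegGraph V ρ × Param V) :
    RegGraph V ρ × Param V :=
  if h : ((allEdges ρ) \ P.1.E).Nonempty then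
    (⟨insert (((allEdges ρ) \ P.1.E).min' h) P.1.E, by
        intro e' he'
        rcases Finset.mem_insert.mp he' with h1 | h1
        · have hmem := Finset.min'_mem ((allEdges ρ) \ P.1.E) h
          have hall : ((allEdges ρ) \ P.1.E).min' h ∈ allEdges ρ :=
            (Finset.mem_sdiff.mp hmem).1
          rw [h1]
          exact (Finset.mem_filter.mp hall).2
        · exact P.1.valid e' h1⟩,
      CompParam P.1 P.2 (((allEdges ρ) \ P.1.E).min' h))
  else P

/-- `P` is a fixed point of `f` reached by iterating `f` from `start`. -/
def IsFixReached {α : Type*} (f : α → α) (start P : α) : Prop :=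
  (∃ n : ℕ, f^[n] start = P) ∧ f P = P

/-- Equality of parametrized regulatory graphs: the graphs coincide and the
parametrizations agree on all regulatory contexts. -/
def PGEq (A B : RegGraph V ρ × Param V) : Prop :=
  A.1 = B.1 ∧ ∀ v : V, ∀ ω ∈ Context A.1 v, A.2 v ω = B.2 v ω

/-- Replacing the value of `K` at component `v` and context `ω` by `j'`. -/
noncomputable def replaceAt (K : Param V) (v : V) (ω : V → ℕ × ℕ) (j' : ℕ) : Param V :=
  fun w ω' => if w = v ∧ ω' = ω then j' else K w ω'

/-- The edge `e = (u,n,v)` is not observable in the parametrization `K`. -/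
def NotObsParam (G : RegGraph V ρ) (K : Param V) (e : V × ℕ × V) : Prop :=
  ∀ ω ∈ Context G e.2.2, ω e.1 = (e.2.1, nplus G e.1 e.2.2 e.2.1) →
    K e.2.2 ω = K e.2.2 (Function.update ω e.1 (nminus G e.1 e.2.2 e.2.1, e.2.1))

/-- The edge `e = (u,n,v)` is not observable in the transition system `T_G(K)`. -/
def NotObsTS (G : RegGraph V ρ) (K : Param V) (e : V × ℕ × V) : Prop :=
  ∀ s ∈ States ρ, nminus G e.1 e.2.2 e.2.1 ≤ s e.1 → s e.1 < nplus G e.1 e.2.2 e.2.1 →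
    ∃ k ≤ ρ e.2.2, ∀ j : ℕ, nminus G e.1 e.2.2 e.2.1 ≤ j → j < nplus G e.1 e.2.2 e.2.1 →
      delta G K e.2.2 (Function.update s e.1 j) =
        Int.sign ((k : ℤ) - ((Function.update s e.1 j) e.2.2 : ℤ))

/-- The monotone target value `(F^K_v)^{mon}(s)`. -/
noncomputable def mon (G : RegGraph V ρ) (K : Param V) (v : V) (s : V → ℕ) : ℕ :=
  if delta G K v s = 0 then s v
  else if delta G K v s = 1 then
    sInf {j | s v < j ∧ delta G K v (Function.update s v j) ≠ 1}
  else
    sSup {j | j < s v ∧ delta G K v (Function.update s v j) ≠ -1}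

/-- Non-observability of `e = (u,n,v)` in `T_G(K)` phrased via monotone target values. -/
def NotObsTSmon (G : RegGraph V ρ) (K : Param V) (e : V × ℕ × V) : Prop :=
  ∀ s ∈ States ρ, nminus G e.1 e.2.2 e.2.1 ≤ s e.1 → s e.1 < nplus G e.1 e.2.2 e.2.1 →
    ∀ j : ℕ, nminus G e.1 e.2.2 e.2.1 ≤ j → j < nplus G e.1 e.2.2 e.2.1 →
      delta G K e.2.2 (Function.update s e.1 j) =
        Int.sign ((mon G K e.2.2 s : ℤ) - ((Function.update s e.1 j) e.2.2 : ℤ))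

/-- In the normalization algorithm: the context below the current one
(the `v`-interval is replaced by its predecessor interval `[n_{i−1}, n_i)`). -/
noncomputable def updLow (G : RegGraph V ρ) (v : V) (ω : V → ℕ × ℕ) : V → ℕ × ℕ :=
  Function.update ω v (sSup {m | m ∈ Theta G v v ∧ m < (ω v).1}, (ω v).1)

/-- In the normalization algorithm: the context above the current one
(the `v`-interval is replaced by its successor interval `[n_{i+1}, n_{i+2})`). -/
noncomputable def updHigh (G : RegGraph V ρ) (v : V) (ω : V → ℕ × ℕ) : V → ℕ × ℕ :=
  Function.update ω v ((ω v).2, sInf {m | m ∈ Theta G v v ∧ (ω v).2 < m})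

/-- The recursive normalization algorithm `Norm(K, v, ω)` of the paper, as an
inductive big-step relation: `NormRel G K v ω r` holds iff the recursion
started at `ω` terminates with result `r`. -/
inductive NormRel (G : RegGraph V ρ) (K : Param V) (v : V) : (V → ℕ × ℕ) → ℕ → Prop
  | inside (ω : V → ℕ × ℕ) (h1 : (ω v).1 ≤ K v ω) (h2 : K v ω < (ω v).2) :
      NormRel G K v ω (K v ω)
  | belowStop (ω : V → ℕ × ℕ) (h : K v ω < (ω v).1)
      (h2 : (ω v).1 - 1 ≤ K v (updLow G v ω)) :
      NormRel G K v ω ((ω v).1 - 1)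
  | belowRec (ω : V → ℕ × ℕ) (r : ℕ) (h : K v ω < (ω v).1)
      (h2 : K v (updLow G v ω) < (ω v).1 - 1)
      (hrec : NormRel G K v (updLow G v ω) r) :
      NormRel G K v ω r
  | aboveStop (ω : V → ℕ × ℕ) (h : (ω v).2 ≤ K v ω)
      (h2 : K v (updHigh G v ω) ≤ (ω v).2) :
      NormRel G K v ω ((ω v).2)
  | aboveRec (ω : V → ℕ × ℕ) (r : ℕ) (h : (ω v).2 ≤ K v ω)
      (h2 : (ω v).2 < K v (updHigh G v ω))
      (hrec : NormRel G K v (updHigh G v ω) r) :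
      NormRel G K v ω r

/-- The normalized parametrization: each context gets the common monotone
target value of its states (represented by the lower corner of the context). -/
noncomputable def NormPm (G : RegGraph V ρ) (K : Param V) : Param V :=
  fun v ω => mon G K v (fun u => (ω u).1)

/-- The edges of `G` that are not observable in `N`. -/
noncomputable def nonObsEdges (G : RegGraph V ρ) (N : Param V) : Finset (V × ℕ × V) :=
  G.E.filter (fun e => NotObsParam G N e)

/-- The parametrization accompanying the removal of the non-observable edge
`e = (u,n,v)`: the two contexts merged into one pass on their common value. -/
noncomputable def MinParam (G : RegGraph V ρ) (N : Param V) (e : V × ℕ × V) : Param V :=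
  fun w ω =>
    if w = e.2.2 ∧ ω e.1 = (nminus G e.1 e.2.2 e.2.1, nplus G e.1 e.2.2 e.2.1)
    then N e.2.2 (Function.update ω e.1 (nminus G e.1 e.2.2 e.2.1, e.2.1))
    else N w ω

/-- One minimization step: remove the least edge (w.r.t. the fixed total order)
that is not observable in `N`; if all edges are observable, do nothing. -/
noncomputable def Minim [LinearOrder (V × ℕ × V)] (P : RegGraph V ρ × Param V) :
    RegGraph V ρ × Param V :=
  if h : (nonObsEdges P.1 P.2).Nonempty then
    (⟨P.1.E.erase ((nonObsEdges P.1 P.2).min' h),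
        fun e' he' => P.1.valid e' (Finset.mem_of_mem_erase he')⟩,
      MinParam P.1 P.2 ((nonObsEdges P.1 P.2).min' h))
  else P


theorem ctx_eq (G : RegGraph V ρ) (u v : V) (s : V → ℕ) (a b : ℕ)
    (ha : a ∈ Theta G u v) (hb : b ∈ Theta G u v) (h1 : a ≤ s u) (h2 : s u < b)
    (h : ∀ l ∈ Theta G u v, ¬ (a < l ∧ l < b)) : ctxOf G v s u = (a, b) := by
  have e1 : IsGreatest {m | m ∈ Theta G u v ∧ m ≤ s u} a := by
    refine ⟨⟨ha, h1⟩, ?_⟩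
    rintro m ⟨hm, hm'⟩
    by_contra hc
    exact h m hm ⟨by omega, by omega⟩
  have e2 : IsLeast {m | m ∈ Theta G u v ∧ s u < m} b := by
    refine ⟨⟨hb, h2⟩, ?_⟩
    rintro m ⟨hm, hm'⟩
    by_contra hc
    exact h m hm ⟨by omega, by omega⟩
  simp only [ctxOf, e1.csSup_eq, e2.csInf_eq]

theorem ctx_spec (G : RegGraph V ρ) (u v : V) (s : V → ℕ) (hs : s u ≤ ρ u) :
    ∃ a b, ctxOf G v s u = (a, b) ∧ a ∈ Theta G u v ∧ b ∈ Theta G u v ∧ a ≤ s u ∧ s u < b ∧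
      ∀ l ∈ Theta G u v, ¬ (a < l ∧ l < b) := by
  have hbd : BddAbove {m | m ∈ Theta G u v ∧ m ≤ s u} := ⟨s u, fun m hm => hm.2⟩
  have m1 : sSup {m | m ∈ Theta G u v ∧ m ≤ s u} ∈ {m | m ∈ Theta G u v ∧ m ≤ s u} :=
    Nat.sSup_mem ⟨0, by simp [Theta], by omega⟩ hbd
  have m2 : sInf {m | m ∈ Theta G u v ∧ s u < m} ∈ {m | m ∈ Theta G u v ∧ s u < m} :=
    Nat.sInf_mem ⟨ρ u + 1, by simp [Theta], by omega⟩
  refine ⟨_, _, rfl, m1.1, m2.1, m1.2, m2.2, ?_⟩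
  rintro l hl ⟨h1, h2⟩
  by_cases hc : l ≤ s u
  · exact absurd (le_csSup hbd ⟨hl, hc⟩) (by simpa using h1)
  · exact absurd (Nat.sInf_le (s := {m | m ∈ Theta G u v ∧ s u < m}) ⟨hl, by omega⟩) (by omega)

theorem nminus_eq (G : RegGraph V ρ) (u v : V) (n a b : ℕ)
    (ha : a ∈ Theta G u v) (h1 : a < n) (h2 : n < b)
    (h : ∀ l ∈ Theta G u v, ¬ (a < l ∧ l < b)) : nminus G u v n = a := by
  have e1 : IsGreatest {m | m ∈ Theta G u v ∧ m < n} a := by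
    refine ⟨⟨ha, h1⟩, ?_⟩
    rintro m ⟨hm, hm'⟩
    by_contra hc
    exact h m hm ⟨by omega, by omega⟩
  exact e1.csSup_eq

theorem nplus_eq (G : RegGraph V ρ) (u v : V) (n a b : ℕ)
    (hb : b ∈ Theta G u v) (h1 : a < n) (h2 : n < b)
    (h : ∀ l ∈ Theta G u v, ¬ (a < l ∧ l < b)) : nplus G u v n = b := by
  have e1 : IsLeast {m | m ∈ Theta G u v ∧ n < m} b := by
    refine ⟨⟨hb, h2⟩, ?_⟩
    rintro m ⟨hm, hm'⟩
    by_contra hc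
    exact h m hm ⟨by omega, by omega⟩
  exact e1.csInf_eq

theorem ctx_mem (G : RegGraph V ρ) (v : V) (s : V → ℕ) (hs : s ∈ States ρ) :
    ctxOf G v s ∈ Context G v := by
  intro u
  obtain ⟨a, b, e, ha, hb, h1, h2, h⟩ := ctx_spec G u v s (hs u)
  rw [e]
  exact ⟨ha, hb, by simp only; omega, h⟩

theorem compParam_ctx (G H : RegGraph V ρ) (K : Param V) (u : V) (n : ℕ) (v : V)
    (hn : 1 ≤ n ∧ n ≤ ρ u) (hnE : (u, n, v) ∉ G.E)
    (hH : ∀ x, x ∈ H.E ↔ x = (u, n, v) ∨ x ∈ G.E)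
    (w : V) (s : V → ℕ) (hs : s ∈ States ρ) :
    CompParam G K (u, n, v) w (ctxOf H w s) = K w (ctxOf G w s) := by
  have hT : ∀ u' w' m, m ∈ Theta H u' w' ↔ (u' = u ∧ m = n ∧ w' = v) ∨ m ∈ Theta G u' w' := by
    intro u' w' m
    simp only [Theta, Set.mem_union, Set.mem_ofPred_eq, hH, Prod.mk.injEq]
    tauto
  have hnT : n ∉ Theta G u v := by
    simp only [Theta, Set.mem_union, Set.mem_ofPred_eq, Set.mem_insert_iff,
      Set.mem_singleton_iff]
    rintro (h | h | h)
    · exact hnE h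
    · omega
    · omega
  have hne : ∀ u' w', ¬ (u' = u ∧ w' = v) → ctxOf H w' s u' = ctxOf G w' s u' := by
    intro u' w' hc
    have : Theta H u' w' = Theta G u' w' := by
      ext m
      rw [hT]
      exact ⟨fun hq => hq.elim (fun hq => absurd ⟨hq.1, hq.2.2⟩ hc) id, Or.inr⟩
    simp only [ctxOf, this]
  by_cases hw : w = v
  · subst hw
    obtain ⟨a, b, e, ha, hb, h1, h2, h⟩ := ctx_spec G u w s (hs u)
    have han : a ≠ n := fun hc => hnT (hc ▸ ha)
    have hbn : b ≠ n := fun hc => hnT (hc ▸ hb)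
    by_cases hin : a < n ∧ n < b
    · have em := nminus_eq G u w n a b ha hin.1 hin.2 h
      have ep := nplus_eq G u w n a b hb hin.1 hin.2 h
      have hctx : ctxOf H w s u = (a, n) ∨ ctxOf H w s u = (n, b) := by
        by_cases hsn : s u < n
        · left
          refine ctx_eq H u w s a n ((hT _ _ _).2 (Or.inr ha)) ((hT _ _ _).2 (by simp)) h1 hsn ?_
          intro l hl hl'
          rcases (hT _ _ _).1 hl with hq | hq
          · omega
          · exact h l hq (by omega)
        · right
          refine ctx_eq H u w s n b ((hT _ _ _).2 (by simp)) ((hT _ _ _).2 (Or.inr hb))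
            (by omega) h2 ?_
          intro l hl hl'
          rcases (hT _ _ _).1 hl with hq | hq
          · omega
          · exact h l hq (by omega)
      simp only [CompParam, em, ep, hctx, and_self, if_true]
      congr 1
      funext u'
      by_cases hu : u' = u
      · subst hu
        simp [e]
      · rw [Function.update_of_ne hu]
        exact hne u' w (by tauto)
    · have hctx : ctxOf H w s u = (a, b) := by
        refine ctx_eq H u w s a b ((hT _ _ _).2 (Or.inr ha)) ((hT _ _ _).2 (Or.inr hb)) h1 h2 ?_
        intro l hl hl'
        rcases (hT _ _ _).1 hl with hq | hq
        · obtain ⟨-, rfl, -⟩ := hq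
          exact hin hl'
        · exact h l hq hl'
      have : ctxOf H w s = ctxOf G w s := by
        funext u'
        by_cases hu : u' = u
        · subst hu
          rw [hctx, e]
        · exact hne u' w (by tauto)
      have hcond : ¬ (ctxOf H w s u = (nminus G u w n, n) ∨
          ctxOf H w s u = (n, nplus G u w n)) := by
        rw [hctx]
        simp only [Prod.mk.injEq]
        tauto
      rw [this] at hcond
      simp only [CompParam, this]
      rw [if_neg (fun hq => hcond hq.2)]
  · have : ctxOf H w s = ctxOf G w s := by
      funext u'
      exact hne u' w (by tauto)
    simp only [CompParam, hw, false_and, if_false, this]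

theorem mem_allEdges (e : V × ℕ × V) : e ∈ allEdges ρ ↔ 1 ≤ e.2.1 ∧ e.2.1 ≤ ρ e.1 := by
  simp only [allEdges, Finset.mem_filter, Finset.mem_product, Finset.mem_univ, true_and,
    Finset.mem_Icc, and_true]
  constructor
  · exact fun h => h.2
  · exact fun h => ⟨⟨h.1, h.2.trans (Finset.le_sup (Finset.mem_univ e.1))⟩, h⟩

theorem comp_ctx [LinearOrder (V × ℕ × V)] (P : RegGraph V ρ × Param V)
    (w : V) (s : V → ℕ) (hs : s ∈ States ρ) :
    (Comp P).2 w (ctxOf (Comp P).1 w s) = P.2 w (ctxOf P.1 w s) := by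
  by_cases h : ((allEdges ρ) \ P.1.E).Nonempty
  · have hmem := Finset.mem_sdiff.mp (Finset.min'_mem ((allEdges ρ) \ P.1.E) h)
    simp only [Comp, dif_pos h]
    refine compParam_ctx P.1 _ P.2 _ _ _ ((mem_allEdges _).1 hmem.1) hmem.2 ?_ w s hs
    intro x
    exact Finset.mem_insert
  · simp only [Comp, dif_neg h]

theorem iter_ctx [LinearOrder (V × ℕ × V)] (n : ℕ) (P : RegGraph V ρ × Param V)
    (w : V) (s : V → ℕ) (hs : s ∈ States ρ) :
    (Comp^[n] P).2 w (ctxOf (Comp^[n] P).1 w s) = P.2 w (ctxOf P.1 w s) := by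
  induction n with
  | zero => rfl
  | succ k ih => rw [Function.iterate_succ_apply', comp_ctx _ w s hs, ih]

theorem fix_complete [LinearOrder (V × ℕ × V)] (P : RegGraph V ρ × Param V)
    (h : Comp P = P) : P.1.E = allEdges ρ := by
  by_cases hn : ((allEdges ρ) \ P.1.E).Nonempty
  · have hmem := Finset.mem_sdiff.mp (Finset.min'_mem ((allEdges ρ) \ P.1.E) hn)
    have h1 : (Comp P).1.E = P.1.E := by rw [h]
    simp only [Comp, dif_pos hn] at h1
    exact absurd (h1.subset (Finset.mem_insert_self _ _)) hmem.2
  · ext e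
    constructor
    · exact fun he => (mem_allEdges e).2 (P.1.valid e he)
    · intro he
      by_contra hc
      exact hn ⟨e, Finset.mem_sdiff.mpr ⟨he, hc⟩⟩

theorem theta_complete (G : RegGraph V ρ) (hG : G.E = allEdges ρ) (u v : V) (m : ℕ) :
    m ∈ Theta G u v ↔ m ≤ ρ u + 1 := by
  simp only [Theta, Set.mem_union, Set.mem_ofPred_eq, hG, mem_allEdges, Set.mem_insert_iff,
      Set.mem_singleton_iff]
  omega

theorem ctx_complete (G : RegGraph V ρ) (hG : G.E = allEdges ρ) (v : V) (s : V → ℕ)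
    (hs : s ∈ States ρ) : ctxOf G v s = fun u => (s u, s u + 1) := by
  funext u
  have := hs u
  refine ctx_eq G u v s _ _ ?_ ?_ le_rfl (by omega) ?_
  · rw [theta_complete G hG]; omega
  · rw [theta_complete G hG]; omega
  · intros; omega

theorem context_complete (G : RegGraph V ρ) (hG : G.E = allEdges ρ) (v : V)
    (ω : V → ℕ × ℕ) (hω : ω ∈ Context G v) : ∃ s ∈ States ρ, ω = ctxOf G v s := by
  have key : ∀ u, (ω u).1 ≤ ρ u ∧ (ω u).2 = (ω u).1 + 1 := by
    intro u
    obtain ⟨-, h2, h3, h4⟩ := hω u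
    rw [theta_complete G hG] at h2
    have := h4 ((ω u).1 + 1) ((theta_complete G hG _ _ _).2 (by omega))
    omega
  have hs : (fun u => (ω u).1) ∈ States ρ := fun u => (key u).1
  refine ⟨fun u => (ω u).1, hs, ?_⟩
  rw [ctx_complete G hG v _ hs]
  funext u
  exact Prod.ext rfl (key u).2

theorem canP_ctx (G0 G : RegGraph V ρ) (hG : G.E = allEdges ρ) (K0 K : Param V) (v : V)
    (s : V → ℕ) (hs : s ∈ States ρ) (h : K v (ctxOf G v s) = K0 v (ctxOf G0 v s)) :
    CanP K v (ctxOf G v s) = F G0 K0 v s := by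
  simp only [CanP, F, h]
  simp only [ctx_complete G hG v s hs]
  split_ifs <;> omega

theorem F_le (G : RegGraph V ρ) (K : Param V) (hK : IsParam G K) (v : V) (s : V → ℕ)
    (hs : s ∈ States ρ) : F G K v s ≤ ρ v := by
  have h1 := hK v _ (ctx_mem G v s hs)
  have h2 := hs v
  unfold F
  split_ifs <;> omega

theorem F_eq_aux (G G' : RegGraph V ρ) (K K' : Param V) (hK : IsParam G K)
    (h : TS G K = TS G' K') (v : V) (s : V → ℕ) (hs : s ∈ States ρ)
    (hne : F G K v s ≠ s v) : F G K v s = F G' K' v s := by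
  have hd : s ≠ Function.update s v (F G K v s) := fun hc => by
    have := congrFun hc v
    rw [Function.update_self] at this
    exact hne this.symm
  have hm : (s, Function.update s v (F G K v s)) ∈ TS G K := by
    refine ⟨hs, ?_, hd, v, rfl⟩
    intro u
    by_cases hu : u = v
    · subst hu
      simpa using F_le G K hK u s hs
    · simpa [hu] using hs u
  rw [h] at hm
  obtain ⟨-, -, -, v', hv'⟩ := hm
  have e := congrFun hv' v
  simp only [Function.update_self] at e
  by_cases hv : v = v'
  · subst hv
    simpa using e
  · rw [Function.update_of_ne hv] at e
    exact absurd e hne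

theorem TS_eq_iff (G G' : RegGraph V ρ) (K K' : Param V) (hK : IsParam G K)
    (hK' : IsParam G' K') :
    TS G K = TS G' K' ↔ ∀ v, ∀ s ∈ States ρ, F G K v s = F G' K' v s := by
  constructor
  · intro h v s hs
    by_cases h1 : F G K v s = s v
    · by_cases h2 : F G' K' v s = s v
      · rw [h1, h2]
      · exact (F_eq_aux G' G K' K hK' h.symm v s hs h2).symm
    · exact F_eq_aux G G' K K' hK h v s hs h1
  · intro h
    ext ⟨s, t⟩
    simp only [TS, Set.mem_ofPred_eq]
    refine and_congr_right fun hs => ?_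
    simp only [h _ s hs]

/-- Two parametrized regulatory graphs (sharing `V` and `ρ`)
generate the same asynchronous transition system iff the canonizations of the
fixed points of their iterated completions coincide. -/
theorem equivalence_via_completion {V : Type*} [DecidableEq V] [Fintype V]
    [LinearOrder (V × ℕ × V)] {ρ : V → ℕ} (hρ : ∀ v, 1 ≤ ρ v)
    (G G' : RegGraph V ρ) (K K' : Param V)
    (hK : IsParam G K) (hK' : IsParam G' K')
    (P P' : RegGraph V ρ × Param V)
    (hP : IsFixReached Comp (G, K) P) (hP' : IsFixReached Comp (G', K') P') :
    TS G K = TS G' K' ↔ PGEq (P.1, CanP P.2) (P'.1, CanP P'.2) := by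
  obtain ⟨⟨n, hn⟩, hf⟩ := hP
  obtain ⟨⟨n', hn'⟩, hf'⟩ := hP'
  have hc := fix_complete P hf
  have hc' := fix_complete P' hf'
  have hG : P.1 = P'.1 := by
    have : P.1.E = P'.1.E := hc.trans hc'.symm
    rcases P with ⟨⟨E, hE⟩, Q⟩
    rcases P' with ⟨⟨E', hE'⟩, Q'⟩
    simp only at this
    subst this
    rfl
  have k1 : ∀ v, ∀ s ∈ States ρ, CanP P.2 v (ctxOf P.1 v s) = F G K v s := by
    intro v s hs
    refine canP_ctx G P.1 hc K P.2 v s hs ?_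
    rw [← hn]
    exact iter_ctx n (G, K) v s hs
  have k2 : ∀ v, ∀ s ∈ States ρ, CanP P'.2 v (ctxOf P'.1 v s) = F G' K' v s := by
    intro v s hs
    refine canP_ctx G' P'.1 hc' K' P'.2 v s hs ?_
    rw [← hn']
    exact iter_ctx n' (G', K') v s hs
  rw [TS_eq_iff G G' K K' hK hK']
  constructor
  · intro h
    refine ⟨hG, ?_⟩
    intro v ω hω
    obtain ⟨s, hs, rfl⟩ := context_complete P.1 hc v ω hω
    change CanP P.2 v (ctxOf P.1 v s) = CanP P'.2 v (ctxOf P.1 v s)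
    rw [k1 v s hs, h v s hs, ← k2 v s hs, hG]
  · rintro ⟨-, h⟩ v s hs
    have := h v _ (ctx_mem P.1 v s hs)
    change CanP P.2 v (ctxOf P.1 v s) = CanP P'.2 v (ctxOf P.1 v s) at this
    rw [← k1 v s hs, ← k2 v s hs, this, hG]

end MVReg
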